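/- Assume the rank-2 roots setup. Let λ = (λ_1 ≥ λ_2 ≥ 0) be a partition with λ_1 ≤ 2k+2. For an integer d ≥ 0, set f_1(z) = z^d (1 − z^{-1})^{λ_1 + 1} and f_2(z) = z^d (1 − z^{-1})^{λ_2}, and let c_d denote the coefficient of T^d in any polynomial F ∈ ℚ[T] with F(τ) = s_{(f_1,f_2)}(z_1,…,z_N). Then: (a) if λ_1 ≤ k, then c_d = 1 for all d ≥ 0; (b) if k < λ_1 ≤ 2k+2 and λ_2 ≥ N, then c_d = 0 for d ≤ 1 and c_d = 1 for d ≥ 2; (c) if k < λ_1 ≤ 2k+1 and λ_2 < N, then c_0 = 0 and c_d = 1 for d ≥ 1; (d) if λ_1 = 2k+2 and λ_2 < N, then c_0 = 0, c_1 = 1 − N + λ_2, and c_d = 1 for d ≥ 2. -/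

import Mathlib

/-- The generalized Schur function `s_{(f_1,…,f_r)}(z_1,…,z_N)` attached to functions
`f_1,…,f_r`: `det(M) / det(z_j^{N-i})` where `M_{i,j} = f_i(z_j)·z_j^{N-i}` for `i ≤ r`
and `M_{i,j} = z_j^{N-i}` for `i > r`. -/
noncomputable def genSchurFun {K : Type*} [Field K] (N r : ℕ) (f : Fin r → K → K)
    (z : Fin N → K) : K :=
  Matrix.det (Matrix.of fun i j : Fin N =>
      (if h : (i : ℕ) < r then f ⟨i, h⟩ (z j) else 1) * z j ^ ((N : ℤ) - 1 - ((i : ℕ) : ℤ))) /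
  Matrix.det (Matrix.of fun i j : Fin N => z j ^ ((N : ℤ) - 1 - ((i : ℕ) : ℤ)))

/-- `s_{(f_1,f_2)}(z_1,…,z_N)` for `f_1(z) = z^d (1-z⁻¹)^{λ_1+1}`,
`f_2(z) = z^d (1-z⁻¹)^{λ_2}`. -/
noncomputable def svalRank2 {K : Type*} [Field K] (N : ℕ) (z : Fin N → K)
    (lam1 lam2 d : ℕ) : K :=
  genSchurFun N 2
    ![fun w => w ^ d * (1 - w⁻¹) ^ (lam1 + 1), fun w => w ^ d * (1 - w⁻¹) ^ lam2] z

/-- The binomial coefficient `n choose j` for integers `n` and `j`, zero when `j < 0`. -/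
noncomputable def intBinom (n j : ℤ) : ℤ := if j < 0 then 0 else Ring.choose n j.toNat

lemma intBinom_neg {n j : ℤ} (h : j < 0) : intBinom n j = 0 := if_pos h

lemma intBinom_natCast (n : ℤ) (j : ℕ) : intBinom n j = Ring.choose n j := by
  simp [intBinom]

lemma intBinom_zero_right (n : ℤ) : intBinom n 0 = 1 := by
  simp [intBinom]

lemma intBinom_natCast_natCast (n j : ℕ) : intBinom n j = n.choose j := by
  rw [intBinom_natCast, Ring.choose_natCast]

lemma intBinom_succ (n j : ℤ) : intBinom (n + 1) j = intBinom n (j - 1) + intBinom n j := by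
  rcases lt_trichotomy j 0 with h | rfl | h
  · rw [intBinom_neg h, intBinom_neg h, intBinom_neg (by lia), add_zero]
  · rw [intBinom_zero_right, intBinom_zero_right, intBinom_neg (by lia), zero_add]
  · obtain ⟨i, rfl⟩ : ∃ i : ℕ, j = ((i + 1 : ℕ) : ℤ) := ⟨(j - 1).toNat, by lia⟩
    rw [show ((i + 1 : ℕ) : ℤ) - 1 = (i : ℕ) by push_cast; ring, intBinom_natCast,
      intBinom_natCast, intBinom_natCast, Ring.choose_succ_succ]

lemma intBinom_of_lt {n j : ℤ} (hn : 0 ≤ n) (h : n < j) : intBinom n j = 0 := by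
  lift n to ℕ using hn
  lift j to ℕ using by lia
  rw [intBinom_natCast_natCast, Nat.choose_eq_zero_of_lt (by lia), Nat.cast_zero]

lemma intBinom_self {n : ℤ} (hn : 0 ≤ n) : intBinom n n = 1 := by
  lift n to ℕ using hn
  rw [intBinom_natCast_natCast, Nat.choose_self, Nat.cast_one]

lemma intBinom_sub_one {n : ℤ} (hn : 0 ≤ n) : intBinom n (n - 1) = n := by
  rcases hn.eq_or_lt with rfl | hn
  · exact intBinom_neg (by lia)
  · obtain ⟨i, rfl⟩ : ∃ i : ℕ, n = ((i + 1 : ℕ) : ℤ) := ⟨(n - 1).toNat, by lia⟩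
    rw [show ((i + 1 : ℕ) : ℤ) - 1 = (i : ℕ) by push_cast; ring, intBinom_natCast_natCast]
    simp

/-- The `T^m`-coefficient of the residue sum of `x^a (x-1)^b / ((x-1)^(k+2) + T x^k)` over the
roots of its denominator. -/
noncomputable def residueCoeff (k : ℕ) (a : ℤ) (b m : ℕ) : ℚ :=
  (-1) ^ m * intBinom (a + m * k) ((k + 2) * (m + 1) - b - 1)

lemma residueCoeff_eq_zero_of_large {k : ℕ} (hk : 1 ≤ k) {a : ℤ} {b m : ℕ}
    (h : a.natAbs + b < m) : residueCoeff k a b m = 0 := by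
  have h1 : (m : ℤ) ≤ m * k := by nlinarith
  have h2 : ((k : ℤ) + 2) * (m + 1) = m * k + k + 2 * m + 2 := by ring
  rw [residueCoeff, intBinom_of_lt (by lia) (by lia)]
  simp

/-- The residue sum of `x^a (x-1)^b / ((x-1)^(k+2) + T x^k)` as a polynomial in `T`. -/
noncomputable def residuePoly (k : ℕ) (a : ℤ) (b : ℕ) : Polynomial ℚ :=
  (PowerSeries.mk (residueCoeff k a b)).trunc (a.natAbs + b + 1)

lemma coeff_residuePoly {k : ℕ} (hk : 1 ≤ k) (a : ℤ) (b m : ℕ) :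
    (residuePoly k a b).coeff m = residueCoeff k a b m := by
  rw [residuePoly, PowerSeries.coeff_trunc, PowerSeries.coeff_mk]
  split_ifs with h
  · rfl
  · exact (residueCoeff_eq_zero_of_large hk (by lia)).symm

lemma residuePoly_succ {k : ℕ} (hk : 1 ≤ k) (a : ℤ) (b : ℕ) :
    residuePoly k (a + 1) b = residuePoly k a (b + 1) + residuePoly k a b := by
  ext m
  simp only [coeff_residuePoly hk, Polynomial.coeff_add, residueCoeff]
  rw [show a + 1 + (m : ℤ) * k = a + m * k + 1 by ring, intBinom_succ]
  push_cast
  rw [show ((k : ℤ) + 2) * (m + 1) - b - 1 - 1 = (k + 2) * (m + 1) - (b + 1) - 1 by ring]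
  ring

lemma residuePoly_add {k : ℕ} (hk : 1 ≤ k) (a : ℤ) (b : ℕ) :
    residuePoly k a (b + (k + 2)) = -(Polynomial.X * residuePoly k (a + k) b) := by
  ext m
  cases m with
  | zero =>
    simp only [coeff_residuePoly hk, Polynomial.coeff_neg, Polynomial.coeff_X_mul_zero,
      residueCoeff]
    rw [intBinom_neg (by push_cast; lia)]
    simp
  | succ m =>
    simp only [coeff_residuePoly hk, Polynomial.coeff_neg, Polynomial.coeff_X_mul, residueCoeff]
    rw [show a + ((m + 1 : ℕ) : ℤ) * k = a + k + m * k by push_cast; ring,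
      show ((k : ℤ) + 2) * ((m + 1 : ℕ) + 1) - (b + (k + 2) : ℕ) - 1
        = (k + 2) * (m + 1) - b - 1 by push_cast; ring]
    ring

lemma residuePoly_zero {k : ℕ} (hk : 1 ≤ k) {b : ℕ} (hb : b < k + 2) :
    residuePoly k 0 b = if b = k + 1 then 1 else 0 := by
  have hmain : ∀ m : ℕ, residueCoeff k 0 b m = if b = k + 1 ∧ m = 0 then 1 else 0 := by
    intro m
    rw [residueCoeff]
    split_ifs with h
    · obtain ⟨rfl, rfl⟩ := h
      rw [show ((k : ℤ) + 2) * ((0 : ℕ) + 1) - (k + 1 : ℕ) - 1 = 0 by push_cast; ring,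
        intBinom_zero_right]
      simp
    · rw [intBinom_of_lt (by positivity) (by
        have : 0 < 2 * (m : ℤ) + (k + 1 - b) := by lia
        linarith)]
      simp
  ext m
  rw [coeff_residuePoly hk, hmain]
  split_ifs <;> simp_all [Polynomial.coeff_one]

/-- A family obeying Pascal's rule in the first index and the `(k+2)`-step reduction in the second
vanishes as soon as it does so at `(0, b)` for `b < k + 2`. -/
lemma eq_zero_of_pascal {K : Type*} [Field K] {k : ℕ} (hk : 1 ≤ k) (t : K) (δ : ℤ → ℕ → K)
    (hsucc : ∀ a b, δ (a + 1) b = δ a (b + 1) + δ a b)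
    (hadd : ∀ a b, δ a (b + (k + 2)) = -(t * δ (a + k) b))
    (hzero : ∀ b, b < k + 2 → δ 0 b = 0) (a : ℤ) (b : ℕ) : δ a b = 0 := by
  have hup : ∀ n b : ℕ, (∀ c, c ≤ b + n → δ 0 c = 0) → δ n b = 0 := by
    intro n
    induction n with
    | zero => intro b h; exact_mod_cast h b (by lia)
    | succ n ih =>
      intro b h
      push_cast
      rw [hsucc, ih _ fun c hc => h c (by lia), ih _ fun c hc => h c (by lia), add_zero]
  have h0 : ∀ b, δ 0 b = 0 := by
    intro b
    induction b using Nat.strong_induction_on with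
    | _ b ih =>
      by_cases hb : b < k + 2
      · exact hzero b hb
      · obtain ⟨c, rfl⟩ : ∃ c, b = c + (k + 2) := ⟨b - (k + 2), by lia⟩
        rw [hadd, zero_add, hup k c fun e he => ih e (by lia), mul_zero, neg_zero]
  have hall : ∀ n : ℕ, ∀ a : ℤ, -(n : ℤ) ≤ a → ∀ b, δ a b = 0 := by
    intro n
    induction n with
    | zero =>
      intro a ha b
      lift a to ℕ using by lia
      exact hup a b fun c _ => h0 c
    | succ n ih =>
      intro a ha b
      have hstep : ∀ c, δ a (c + 1) = -δ a c := by
        intro c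
        have := hsucc a c
        rw [ih _ (by lia)] at this
        linear_combination -this
      have hiter : ∀ j, δ a (b + j) = (-1) ^ j * δ a b := by
        intro j
        induction j with
        | zero => simp
        | succ j ihj => rw [← add_assoc, hstep, ihj]; ring
      have := hiter (k + 2)
      rw [hadd, ih _ (by lia), mul_zero, neg_zero] at this
      exact (mul_eq_zero.1 this.symm).resolve_left (pow_ne_zero _ (by simp))
  exact hall a.natAbs a (by lia) b

section Interpolation

open Polynomial

variable {K : Type*} [Field K]

/-- The coefficient of `X^l` in the polynomial interpolating the values `w` at the nodes `z`. -/
noncomputable def interpCoeff {n : ℕ} (z : Fin n → K) (l : ℕ) : (Fin n → K) →ₗ[K] K :=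
  Polynomial.lcoeff K l ∘ₗ Lagrange.interpolate Finset.univ z

lemma interpCoeff_eval {n : ℕ} {z : Fin n → K} (hz : Function.Injective z) (l : ℕ) {p : K[X]}
    (hp : p.degree < n) : interpCoeff z l (fun i => p.eval (z i)) = p.coeff l := by
  have := Lagrange.eq_interpolate (s := Finset.univ) (f := p) hz.injOn (by simpa using hp)
  simp [interpCoeff, ← this]

lemma sum_interpCoeff {n : ℕ} {z : Fin n → K} (hz : Function.Injective z) (w : Fin n → K)
    (j : Fin n) : ∑ l : Fin n, interpCoeff z l w * z j ^ (l : ℕ) = w j := by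
  have hdeg := Lagrange.degree_interpolate_lt (s := Finset.univ) w hz.injOn
  have heval := Lagrange.eval_interpolate_at_node (s := Finset.univ) w hz.injOn
    (Finset.mem_univ j)
  rw [Finset.card_univ, Fintype.card_fin] at hdeg
  have hnat : (Lagrange.interpolate Finset.univ z w).natDegree < n := by
    by_cases h : Lagrange.interpolate Finset.univ z w = 0
    · simpa [h] using j.pos
    · exact (natDegree_lt_iff_degree_lt h).2 hdeg
  rw [Polynomial.eval_eq_sum_range' hnat,
    ← Fin.sum_univ_eq_sum_range
      (fun l => (Lagrange.interpolate Finset.univ z w).coeff l * z j ^ l)] at heval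
  exact heval

lemma det_two_rows_div {k : ℕ} {z : Fin (k + 2) → K} (hz : Function.Injective z)
    (M : Matrix (Fin (k + 2)) (Fin (k + 2)) K)
    (hM : ∀ i : Fin (k + 2), 2 ≤ (i : ℕ) → ∀ j, M i j = z j ^ (k + 1 - (i : ℕ))) :
    M.det / (Matrix.of fun i j : Fin (k + 2) => z j ^ (k + 1 - (i : ℕ))).det =
      interpCoeff z (k + 1) (M 0) * interpCoeff z k (M 1) -
        interpCoeff z k (M 0) * interpCoeff z (k + 1) (M 1) := by
  set V : Matrix (Fin (k + 2)) (Fin (k + 2)) K := Matrix.of fun i j => z j ^ (k + 1 - (i : ℕ))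
    with hV
  set R : Matrix (Fin (k + 2)) (Fin (k + 2)) K :=
    Matrix.of fun i l => interpCoeff z (k + 1 - (l : ℕ)) (M i) with hR
  have hMRV : M = R * V := by
    ext i j
    rw [Matrix.mul_apply, ← sum_interpCoeff hz (M i) j, ← Equiv.sum_comp Fin.revPerm]
    refine Finset.sum_congr rfl fun l _ => ?_
    simp only [hR, hV, Matrix.of_apply, Fin.revPerm_apply, Fin.val_rev]
    rw [show k + 2 - ((l : ℕ) + 1) = k + 1 - l by lia]
  have hVdet : V.det ≠ 0 := by
    have : V = (Matrix.vandermonde z).transpose.submatrix Fin.revPerm id := by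
      ext i j
      simp only [hV, Matrix.of_apply, Matrix.submatrix_apply, Matrix.transpose_apply,
        Matrix.vandermonde_apply, Fin.revPerm_apply, Fin.val_rev, id]
      congr 1
      lia
    rw [this, Matrix.det_permute, Matrix.det_transpose]
    refine mul_ne_zero ?_ (Matrix.det_vandermonde_ne_zero_iff.2 hz)
    rcases Int.units_eq_one_or (Equiv.Perm.sign (Fin.revPerm : Equiv.Perm (Fin (k + 2)))) with
      h | h <;> simp [h]
  have hRrow : ∀ i l : Fin (k + 2), 2 ≤ (i : ℕ) → R i l = if i = l then 1 else 0 := by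
    intro i l hi
    have : M i = fun j => (X ^ (k + 1 - (i : ℕ)) : K[X]).eval (z j) := by
      ext j
      simp [hM i hi j]
    simp only [hR, Matrix.of_apply]
    rw [this, interpCoeff_eval hz _ (by rw [degree_X_pow]; exact_mod_cast (by lia)), coeff_X_pow]
    refine if_congr ?_ rfl rfl
    rw [Fin.ext_iff]
    lia
  have hRdet : R.det = R 0 0 * R 1 1 - R 0 1 * R 1 0 := by
    rw [Matrix.twoBlockTriangular_det R (fun i => (i : ℕ) < 2)
      fun i hi j hj => by
        rw [hRrow i j (by lia), if_neg (by rintro rfl; exact hi hj)]]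
    have h1 : (R.toSquareBlockProp fun i => ¬ (i : ℕ) < 2) = 1 := by
      ext ⟨i, hi⟩ ⟨j, hj⟩
      simp [Matrix.toSquareBlockProp, Matrix.one_apply, hRrow i j (by lia)]
    let e : Fin 2 ≃ {i : Fin (k + 2) // (i : ℕ) < 2} :=
      { toFun := fun i => ⟨⟨i, by lia⟩, i.2⟩
        invFun := fun i => ⟨i.1, i.2⟩
        left_inv := fun i => rfl
        right_inv := fun i => rfl }
    rw [h1, Matrix.det_one, mul_one, ← Matrix.det_submatrix_equiv_self e, Matrix.det_fin_two]
    rfl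
  rw [hMRV, Matrix.det_mul, mul_div_assoc, div_self hVdet, mul_one, hRdet, ← hMRV]
  simp [hR]

lemma interpCoeff_node_mul {k : ℕ} {z : Fin (k + 2) → K} (hz : Function.Injective z) :
    ∃ c : K, ∀ w : Fin (k + 2) → K, interpCoeff z (k + 1) (fun i => z i * w i) =
      interpCoeff z k w + c * interpCoeff z (k + 1) w := by
  set P : K[X] := ∏ i, (X - C (z i)) with hP
  have hmonic : P.Monic := monic_prod_of_monic _ _ fun i _ => monic_X_sub_C _
  have hdegP : P.natDegree = k + 2 := by
    rw [hP, natDegree_prod_of_monic _ _ fun i _ => monic_X_sub_C _]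
    simp
  refine ⟨-P.coeff (k + 1), fun w => ?_⟩
  set r := Lagrange.interpolate Finset.univ z w with hr
  have hdeg := Lagrange.degree_interpolate_lt (s := Finset.univ) w hz.injOn
  rw [Finset.card_univ, Fintype.card_fin, ← hr, degree_lt_iff_coeff_zero] at hdeg
  have hq : (X * r - C (r.coeff (k + 1)) * P).degree < ((k + 2 : ℕ) : WithBot ℕ) := by
    rw [degree_lt_iff_coeff_zero]
    intro m hm
    obtain ⟨m, rfl⟩ : ∃ l, m = l + 1 := ⟨m - 1, by lia⟩
    rw [coeff_sub, coeff_X_mul, coeff_C_mul]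
    rcases hm.eq_or_lt with h | h
    · rw [← h, ← hdegP, hmonic.coeff_natDegree, show m = k + 1 by lia, mul_one, sub_self]
    · rw [hdeg m (by lia), coeff_eq_zero_of_natDegree_lt (p := P) (by lia), mul_zero, sub_zero]
  have heval : (fun i => z i * w i) =
      fun i => (X * r - C (r.coeff (k + 1)) * P).eval (z i) := by
    ext i
    have hroot : P.eval (z i) = 0 := by
      rw [hP, eval_prod]
      exact Finset.prod_eq_zero (Finset.mem_univ i) (by simp)
    rw [eval_sub, eval_mul, eval_mul, hroot, hr,
      Lagrange.eval_interpolate_at_node (s := Finset.univ) w hz.injOn (Finset.mem_univ i)]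
    simp
  rw [heval, interpCoeff_eval hz _ hq, coeff_sub, coeff_X_mul, coeff_C_mul]
  simp only [interpCoeff, LinearMap.comp_apply, lcoeff_apply, ← hr]
  ring

lemma pow_add_eq_zero_of_roots {k : ℕ} {τ : K} {z : Fin (k + 2) → K}
    (hroots : ∏ i, (X - C (z i)) = (X - C (1 : K)) ^ (k + 2) + C τ * X ^ k) (i : Fin (k + 2)) :
    (z i - 1) ^ (k + 2) + τ * z i ^ k = 0 := by
  have h := congrArg (eval (z i)) hroots
  rw [eval_prod, Finset.prod_eq_zero (Finset.mem_univ i) (by simp)] at h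
  simpa using h.symm

lemma ne_zero_of_roots {k : ℕ} (hk : 1 ≤ k) {τ : K} {z : Fin (k + 2) → K}
    (hroots : ∏ i, (X - C (z i)) = (X - C (1 : K)) ^ (k + 2) + C τ * X ^ k) (i : Fin (k + 2)) :
    z i ≠ 0 := by
  intro h
  have := pow_add_eq_zero_of_roots hroots i
  rw [h, zero_pow (by lia), mul_zero, add_zero, zero_sub] at this
  exact pow_ne_zero _ (neg_ne_zero.2 one_ne_zero) this

/-- The leading interpolation coefficient of Laurent monomials `x^a (x-1)^b` at the roots of
`(x-1)^(k+2) + τ x^k` is given by the residue polynomials. -/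
lemma interpCoeff_eq_aeval [CharZero K] {k : ℕ} (hk : 1 ≤ k) (τ : K) {z : Fin (k + 2) → K}
    (hz : Function.Injective z)
    (hroots : ∏ i, (X - C (z i)) = (X - C (1 : K)) ^ (k + 2) + C τ * X ^ k) (a : ℤ) (b : ℕ) :
    interpCoeff z (k + 1) (fun i => z i ^ a * (z i - 1) ^ b) = aeval τ (residuePoly k a b) := by
  have hroot := pow_add_eq_zero_of_roots hroots
  have hz0 := ne_zero_of_roots hk hroots
  rw [← sub_eq_zero]
  refine eq_zero_of_pascal hk τ (fun a b => interpCoeff z (k + 1)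
    (fun i => z i ^ a * (z i - 1) ^ b) - aeval τ (residuePoly k a b)) ?_ ?_ ?_ a b
  · intro a b
    have : (fun i => z i ^ (a + 1) * (z i - 1) ^ b) =
        (fun i => z i ^ a * (z i - 1) ^ (b + 1)) + fun i => z i ^ a * (z i - 1) ^ b := by
      ext i
      rw [Pi.add_apply, zpow_add_one₀ (hz0 i)]
      ring
    simp only [this, map_add, residuePoly_succ hk]
    ring
  · intro a b
    have : (fun i => z i ^ a * (z i - 1) ^ (b + (k + 2))) =
        (-τ) • fun i => z i ^ (a + k) * (z i - 1) ^ b := by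
      ext i
      rw [Pi.smul_apply, smul_eq_mul, zpow_add₀ (hz0 i), zpow_natCast]
      linear_combination z i ^ a * (z i - 1) ^ b * hroot i
    simp only [this, map_smul, residuePoly_add hk, map_neg, map_mul, aeval_X, smul_eq_mul]
    ring
  · intro b hb
    have : (fun i => z i ^ (0 : ℤ) * (z i - 1) ^ b) =
        fun i => ((X - C 1 : K[X]) ^ b).eval (z i) := by
      ext i
      simp
    have hmonic : ((X - C 1 : K[X]) ^ b).Monic := (monic_X_sub_C 1).pow b
    have hnat : ((X - C 1 : K[X]) ^ b).natDegree = b := by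
      rw [natDegree_pow, natDegree_X_sub_C, mul_one]
    rw [this, interpCoeff_eval hz _ (by
      rw [degree_eq_natDegree hmonic.ne_zero, hnat]; exact_mod_cast hb), residuePoly_zero hk hb]
    split_ifs with h
    · rw [← h]
      nth_rewrite 2 [← hnat]
      rw [hmonic.coeff_natDegree, map_one, sub_self]
    · rw [coeff_eq_zero_of_natDegree_lt (by lia), map_zero, sub_self]

lemma svalRank2_eq_aeval [CharZero K] {k : ℕ} (hk : 1 ≤ k) (τ : K) {z : Fin (k + 2) → K}
    (hz : Function.Injective z)
    (hroots : ∏ i, (X - C (z i)) = (X - C (1 : K)) ^ (k + 2) + C τ * X ^ k) (lam1 lam2 d : ℕ) :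
    svalRank2 (k + 2) z lam1 lam2 d = aeval τ
      (residuePoly k (d + k - lam1) (lam1 + 1) * residuePoly k (d + k - lam2) (lam2 + 1) -
        residuePoly k (d + k - lam1) (lam1 + 2) * residuePoly k (d + k - lam2) lam2) := by
  have hz0 := ne_zero_of_roots hk hroots
  have hpow : ∀ i j : Fin (k + 2),
      z j ^ (((k + 2 : ℕ) : ℤ) - 1 - (i : ℕ)) = z j ^ (k + 1 - (i : ℕ)) := by
    intro i j
    rw [← zpow_natCast]
    congr 1
    have := i.isLt
    lia
  obtain ⟨c, hc⟩ := interpCoeff_node_mul hz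
  have hc' : ∀ w : Fin (k + 2) → K, interpCoeff z (k + 1) (fun i => (z i - 1) * w i) =
      interpCoeff z k w + (c - 1) * interpCoeff z (k + 1) w := by
    intro w
    have : (fun i => (z i - 1) * w i) = (fun i => z i * w i) - w := by
      ext i
      simp [sub_mul]
    rw [this, map_sub, hc]
    ring
  have hrow : ∀ (a : ℤ) (b : ℕ), interpCoeff z k (fun i => z i ^ a * (z i - 1) ^ b) =
      aeval τ (residuePoly k a (b + 1)) - (c - 1) * aeval τ (residuePoly k a b) := by
    intro a b
    rw [← interpCoeff_eq_aeval hk τ hz hroots, ← interpCoeff_eq_aeval hk τ hz hroots,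
      eq_sub_iff_add_eq, ← hc']
    congr 1
    ext i
    ring
  have hlaurent : ∀ (x : K) (l e : ℕ), x ≠ 0 →
      x ^ d * (1 - x⁻¹) ^ l * x ^ e = x ^ ((d : ℤ) + e - l) * (x - 1) ^ l := by
    intro x l e hx
    rw [zpow_sub₀ hx, zpow_add₀ hx]
    simp only [zpow_natCast]
    rw [show x - 1 = x * (1 - x⁻¹) by field_simp, mul_pow]
    field_simp
  rw [svalRank2, genSchurFun]
  simp only [hpow]
  rw [det_two_rows_div hz _ fun i hi j => by
    rw [Matrix.of_apply, dif_neg (by lia), one_mul]]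
  have h0 : (Matrix.of (fun i j : Fin (k + 2) => (if h : (i : ℕ) < 2 then
      (![fun w => w ^ d * (1 - w⁻¹) ^ (lam1 + 1), fun w => w ^ d * (1 - w⁻¹) ^ lam2] :
        Fin 2 → K → K) ⟨i, h⟩ (z j) else 1) * z j ^ (k + 1 - (i : ℕ)))) 0 =
      fun j => z j ^ ((d : ℤ) + k - lam1) * (z j - 1) ^ (lam1 + 1) := by
    ext j
    have := hlaurent (z j) (lam1 + 1) (k + 1) (hz0 j)
    rw [show (d : ℤ) + (k + 1 : ℕ) - (lam1 + 1 : ℕ) = d + k - lam1 by push_cast; ring] at this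
    simpa using this
  have h1 : (Matrix.of (fun i j : Fin (k + 2) => (if h : (i : ℕ) < 2 then
      (![fun w => w ^ d * (1 - w⁻¹) ^ (lam1 + 1), fun w => w ^ d * (1 - w⁻¹) ^ lam2] :
        Fin 2 → K → K) ⟨i, h⟩ (z j) else 1) * z j ^ (k + 1 - (i : ℕ)))) 1 =
      fun j => z j ^ ((d : ℤ) + k - lam2) * (z j - 1) ^ lam2 := by
    ext j
    simpa using hlaurent (z j) lam2 k (hz0 j)
  rw [h0, h1, hrow, hrow, interpCoeff_eq_aeval hk τ hz hroots,
    interpCoeff_eq_aeval hk τ hz hroots]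
  simp only [map_sub, map_mul]
  ring

end Interpolation

section Coefficients

variable {k d lam : ℕ}

lemma residueCoeff_eq_zero (hgood : lam ≤ k ∨ 2 ≤ d ∧ lam ≤ 2 * k + 2) {t m : ℕ}
    (h : d + t < 2 * m + 1) : residueCoeff k (d + k - lam) (lam + t) m = 0 := by
  have hlow : ((k : ℤ) + 2) * (m + 1) = m * k + k + 2 * m + 2 := by ring
  rw [residueCoeff]
  by_cases hneg : 0 ≤ (d : ℤ) + k - lam + m * k
  · rw [intBinom_of_lt hneg (by push_cast; lia), Int.cast_zero, mul_zero]
  · have hm : m = 0 := by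
      by_contra hm
      have : (1 : ℤ) * k ≤ m * k := by gcongr; lia
      lia
    subst hm
    rw [intBinom_neg (by push_cast at *; lia), Int.cast_zero, mul_zero]

lemma residueCoeff_eq_neg_one_pow (hgood : lam ≤ k ∨ 2 ≤ d ∧ lam ≤ 2 * k + 2) {t m : ℕ}
    (h : d + t = 2 * m + 1) :
    residueCoeff k (d + k - lam) (lam + t) m = (-1) ^ m := by
  have hlow : ((k : ℤ) + 2) * (m + 1) = m * k + k + 2 * m + 2 := by ring
  have hpos : (0 : ℤ) ≤ m * k := by positivity
  have hnonneg : 0 ≤ (d : ℤ) + k - lam + m * k := by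
    rcases hgood with hl | ⟨hd, hl⟩
    · lia
    · have : (1 : ℤ) * k ≤ m * k := by gcongr; lia
      lia
  rw [residueCoeff, show ((k : ℤ) + 2) * (m + 1) - (lam + t : ℕ) - 1 = d + k - lam + m * k by
    push_cast; lia, intBinom_self hnonneg, Int.cast_one, mul_one]

lemma coeff_residuePoly_mul (hk : 1 ≤ k) {lam' : ℕ} (h : lam ≤ k ∨ 2 ≤ d ∧ lam ≤ 2 * k + 2)
    (h' : lam' ≤ k ∨ 2 ≤ d ∧ lam' ≤ 2 * k + 2) {t t' : ℕ} (ht : t + t' = 2) :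
    (residuePoly k (d + k - lam) (lam + t) * residuePoly k (d + k - lam') (lam' + t')).coeff d =
      if Odd (d + t) then (-1) ^ d else 0 := by
  simp only [Polynomial.coeff_mul, coeff_residuePoly hk]
  have hvanish : ∀ p ∈ Finset.HasAntidiagonal.antidiagonal d, d + t ≠ 2 * p.1 + 1 →
      residueCoeff k (d + k - lam) (lam + t) p.1 *
        residueCoeff k (d + k - lam') (lam' + t') p.2 = 0 := by
    intro p hp hne
    rw [Finset.HasAntidiagonal.mem_antidiagonal] at hp
    rcases lt_or_gt_of_ne hne with hlt | hlt
    · rw [residueCoeff_eq_zero h hlt, zero_mul]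
    · rw [residueCoeff_eq_zero h' (m := p.2) (by lia), mul_zero]
  split_ifs with hodd
  · obtain ⟨m, hm⟩ := hodd
    rw [Finset.sum_eq_single (m, d - m)]
    · rw [residueCoeff_eq_neg_one_pow h hm,
        residueCoeff_eq_neg_one_pow h' (m := d - m) (by lia), ← pow_add]
      congr 1
      lia
    · intro p hp hne
      refine hvanish p hp fun h1 => hne ?_
      rw [Finset.HasAntidiagonal.mem_antidiagonal] at hp
      ext <;> simp only <;> lia
    · intro hmem
      exact absurd (Finset.HasAntidiagonal.mem_antidiagonal.2 (by simp only; lia)) hmem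
  · exact Finset.sum_eq_zero fun p hp => hvanish p hp fun h1 => hodd ⟨p.1, h1⟩

/-- The polynomial `F` with `F(τ) = s_{(f_1,f_2)}(z)` for the rank-2 roots setup. -/
noncomputable def schurPoly (k lam1 lam2 d : ℕ) : Polynomial ℚ :=
  residuePoly k (d + k - lam1) (lam1 + 1) * residuePoly k (d + k - lam2) (lam2 + 1) -
    residuePoly k (d + k - lam1) (lam1 + 2) * residuePoly k (d + k - lam2) lam2

variable {lam1 lam2 : ℕ}

lemma coeff_schurPoly (hk : 1 ≤ k) (hlam : lam2 ≤ lam1)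
    (hgood : lam1 ≤ k ∨ 2 ≤ d ∧ lam1 ≤ 2 * k + 2) : (schurPoly k lam1 lam2 d).coeff d = 1 := by
  have hgood' : lam2 ≤ k ∨ 2 ≤ d ∧ lam2 ≤ 2 * k + 2 := by lia
  have h1 := coeff_residuePoly_mul hk hgood hgood' (t := 1) (t' := 1) rfl
  have h2 := coeff_residuePoly_mul hk hgood hgood' (t := 2) (t' := 0) rfl
  rw [add_zero] at h2
  rw [schurPoly, Polynomial.coeff_sub, h1, h2]
  rcases Nat.even_or_odd d with hd | hd
  · have hd2 : ¬ Odd (d + 2) := by grind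
    rw [if_pos hd.add_one, if_neg hd2, hd.neg_one_pow, sub_zero]
  · have hd1 : ¬ Odd (d + 1) := by grind
    have hd2 : Odd (d + 2) := by grind
    rw [if_neg hd1, if_pos hd2, hd.neg_one_pow, zero_sub, neg_neg]

lemma residueCoeff_zero_of_lt (hlam : k < lam) {t : ℕ} (ht : 1 ≤ t) (a : ℤ) :
    residueCoeff k a (lam + t) 0 = 0 := by
  rw [residueCoeff, intBinom_neg (by push_cast; lia), Int.cast_zero, mul_zero]

lemma coeff_zero_schurPoly (hk : 1 ≤ k) (hlam : k < lam1) :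
    (schurPoly k lam1 lam2 0).coeff 0 = 0 := by
  simp [schurPoly, Polynomial.mul_coeff_zero, coeff_residuePoly hk,
    residueCoeff_zero_of_lt hlam]

lemma coeff_one_schurPoly (hk : 1 ≤ k) (hlam : k < lam1) :
    (schurPoly k lam1 lam2 1).coeff 1 =
      intBinom (1 + 2 * k - lam1) (2 * k + 1 - lam1) * intBinom (1 + k - lam2) (k + 1 - lam2) -
        intBinom (1 + 2 * k - lam1) (2 * k + 2 - lam1) * intBinom (1 + k - lam2) (k - lam2) := by
  rw [schurPoly, Polynomial.coeff_sub, Polynomial.mul_coeff_one, Polynomial.mul_coeff_one]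
  simp only [coeff_residuePoly hk, residueCoeff_zero_of_lt hlam one_le_two,
    residueCoeff_zero_of_lt hlam le_rfl]
  simp only [residueCoeff]
  push_cast
  ring_nf

end Coefficients

/-- Rank-2 roots setup (`k = N-2`,
`∏(X - z_i) = (X-1)^N + τ X^{N-2}`, `τ` transcendental over `ℚ`). For a partition
`λ = (λ_1 ≥ λ_2 ≥ 0)` with `λ_1 ≤ 2k+2`, the coefficient `c_d` of `T^d` in any
`F ∈ ℚ[T]` with `F(τ) = s_{(f_1,f_2)}(z)` satisfies the four-case formula. -/
theorem stmt10 {K : Type*} [Field K] [CharZero K] (N : ℕ) (hN : 3 ≤ N)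
    (k : ℕ) (hk : k = N - 2)
    (τ : K) (hτ : Transcendental ℚ τ)
    (z : Fin N → K) (hz : Function.Injective z)
    (hroots : ∏ i, (Polynomial.X - Polynomial.C (z i)) =
      (Polynomial.X - Polynomial.C (1 : K)) ^ N + Polynomial.C τ * Polynomial.X ^ (N - 2))
    (lam1 lam2 : ℕ) (hlam : lam2 ≤ lam1) (hup : lam1 ≤ 2 * k + 2) :
    -- (a)
    (lam1 ≤ k → ∀ d : ℕ, ∀ F : Polynomial ℚ,
      Polynomial.aeval τ F = svalRank2 N z lam1 lam2 d → F.coeff d = 1) ∧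
    -- (b)
    (k < lam1 → N ≤ lam2 →
      (∀ d : ℕ, d ≤ 1 → ∀ F : Polynomial ℚ,
        Polynomial.aeval τ F = svalRank2 N z lam1 lam2 d → F.coeff d = 0) ∧
      (∀ d : ℕ, 2 ≤ d → ∀ F : Polynomial ℚ,
        Polynomial.aeval τ F = svalRank2 N z lam1 lam2 d → F.coeff d = 1)) ∧
    -- (c)
    (k < lam1 → lam1 ≤ 2 * k + 1 → lam2 < N →
      (∀ F : Polynomial ℚ,
        Polynomial.aeval τ F = svalRank2 N z lam1 lam2 0 → F.coeff 0 = 0) ∧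
      (∀ d : ℕ, 1 ≤ d → ∀ F : Polynomial ℚ,
        Polynomial.aeval τ F = svalRank2 N z lam1 lam2 d → F.coeff d = 1)) ∧
    -- (d)
    (lam1 = 2 * k + 2 → lam2 < N →
      (∀ F : Polynomial ℚ,
        Polynomial.aeval τ F = svalRank2 N z lam1 lam2 0 → F.coeff 0 = 0) ∧
      (∀ F : Polynomial ℚ,
        Polynomial.aeval τ F = svalRank2 N z lam1 lam2 1 →
          F.coeff 1 = 1 - (N : ℚ) + (lam2 : ℚ)) ∧
      (∀ d : ℕ, 2 ≤ d → ∀ F : Polynomial ℚ,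
        Polynomial.aeval τ F = svalRank2 N z lam1 lam2 d → F.coeff d = 1)) := by
  obtain rfl : N = k + 2 := by lia
  have hk1 : 1 ≤ k := by lia
  have key : ∀ d F, Polynomial.aeval τ F = svalRank2 (k + 2) z lam1 lam2 d →
      F = schurPoly k lam1 lam2 d := fun d F hF =>
    transcendental_iff_injective.1 hτ (hF.trans (svalRank2_eq_aeval hk1 τ hz hroots _ _ _))
  have hlarge : ∀ d, 2 ≤ d → ∀ F : Polynomial ℚ,
      Polynomial.aeval τ F = svalRank2 (k + 2) z lam1 lam2 d → F.coeff d = 1 := fun d hd F hF => by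
    rw [key d F hF, coeff_schurPoly hk1 hlam (Or.inr ⟨hd, hup⟩)]
  refine ⟨fun h d F hF => ?_, fun h h2 => ⟨fun d hd F hF => ?_, hlarge⟩,
    fun h hup' h2 => ⟨fun F hF => ?_, fun d hd F hF => ?_⟩,
    fun h h2 => ⟨fun F hF => ?_, fun F hF => ?_, hlarge⟩⟩
  · rw [key d F hF, coeff_schurPoly hk1 hlam (Or.inl h)]
  · rw [key d F hF]
    obtain rfl | rfl : d = 0 ∨ d = 1 := by lia
    · exact coeff_zero_schurPoly hk1 h
    · rw [coeff_one_schurPoly hk1 h, intBinom_neg (j := k + 1 - lam2) (by lia),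
        intBinom_neg (j := k - lam2) (by lia)]
      simp
  · rw [key 0 F hF, coeff_zero_schurPoly hk1 h]
  · rcases hd.eq_or_lt with rfl | hd
    · rw [key 1 F hF, coeff_one_schurPoly hk1 h,
        show (2 * k + 1 - lam1 : ℤ) = 1 + 2 * k - lam1 by ring,
        show (k + 1 - lam2 : ℤ) = 1 + k - lam2 by ring, intBinom_self (by lia),
        intBinom_self (by lia), intBinom_of_lt (j := 2 * k + 2 - lam1) (by lia) (by lia)]
      simp
    · exact hlarge d hd F hF
  · rw [key 0 F hF, coeff_zero_schurPoly hk1 (by lia)]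
  · rw [key 1 F hF, coeff_one_schurPoly hk1 (by lia),
      intBinom_neg (j := 2 * k + 1 - lam1) (by lia),
      show (2 * k + 2 - lam1 : ℤ) = 0 by lia, intBinom_zero_right,
      show (k - lam2 : ℤ) = 1 + k - lam2 - 1 by ring, intBinom_sub_one (by lia)]
    push_cast
    ring
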